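/- arXiv:1204.1877 — 6 statements merged into one kernel-verified Lean document; each statement's English description precedes it below -/
import Mathlib

section
/- Let f : ℝ → ℝ be continuous and let a < b. If there exists ε₀ > 0 such that f(x) = f⁺(x,ε₀) for all x ∈ (a,b), then f is differentiable at every point x of (a,b), with derivative f'(x) = (f(x+ε₀) − f(x))/ε₀. -/
open MeasureTheory Set

/-- For `f : ℝ → ℝ` and `ε > 0`, the right mean function
`f⁺(x, ε) = (1/ε) ∫_x^{x+ε} f(t) dt`. -/
noncomputable def rightMean (f : ℝ → ℝ) (x ε : ℝ) : ℝ :=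
  (1 / ε) * ∫ t in x..(x + ε), f t

theorem hasDerivAt_rightMean {f : ℝ → ℝ} (hf : Continuous f) (x ε : ℝ) :
    HasDerivAt (fun y => rightMean f y ε) ((f (x + ε) - f x) / ε) x := by
  have hF (y : ℝ) : HasDerivAt (fun u => ∫ t in (0 : ℝ)..u, f t) (f y) y :=
    hf.integral_hasStrictDerivAt 0 y |>.hasDerivAt
  have hd := (((hF (x + ε)).comp_add_const x ε).sub (hF x)).const_mul (1 / ε)
  rw [one_div_mul_eq_div] at hd
  refine hd.congr_of_eventuallyEq (.of_forall fun y => ?_)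
  simp [rightMean, intervalIntegral.integral_interval_sub_left
    (hf.intervalIntegrable _ _) (hf.intervalIntegrable _ _)]

/-- If `f` is continuous, `a < b`, and there is `ε₀ > 0` with `f(x) = f⁺(x, ε₀)`
for all `x ∈ (a, b)`, then `f` is differentiable at every point `x` of `(a, b)`
with derivative `(f(x + ε₀) - f(x)) / ε₀`. -/
theorem differentiable_of_eq_rightMean (f : ℝ → ℝ) (hf : Continuous f)
    (a b : ℝ) (hab : a < b) (ε₀ : ℝ) (hε₀ : 0 < ε₀)
    (h : ∀ x ∈ Ioo a b, f x = rightMean f x ε₀) :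
    ∀ x ∈ Ioo a b, HasDerivAt f ((f (x + ε₀) - f x) / ε₀) x := by
  intro x hx
  exact (hasDerivAt_rightMean hf x ε₀).congr_of_eventuallyEq
    (Filter.eventually_of_mem (Ioo_mem_nhds hx.1 hx.2) h)
end

section
/- Let f : ℝ → ℝ be continuous and let a < b. If there exists a point of (a,b) at which f is not differentiable, then for every ε > 0 there exists x ∈ (a,b) such that f(x) ≠ f⁺(x,ε), i.e., the deviation Δ_ε f(x) = f(x) − f⁺(x,ε) is nonzero. -/
open MeasureTheory Set

/-- The right mean function of a continuous function is differentiable. -/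
theorem differentiable_rightMean {f : ℝ → ℝ} (hf : Continuous f) (ε : ℝ) :
    Differentiable ℝ fun x => rightMean f x ε := by
  have hF : Differentiable ℝ fun u => ∫ t in (0 : ℝ)..u, f t := fun u =>
    (hf.integral_hasStrictDerivAt 0 u).hasDerivAt.differentiableAt
  have heq : (fun x => rightMean f x ε) = fun x =>
      (1 / ε) * ((∫ t in (0 : ℝ)..(x + ε), f t) - ∫ t in (0 : ℝ)..x, f t) := by
    funext x
    rw [rightMean, intervalIntegral.integral_interval_sub_left
      (hf.intervalIntegrable _ _) (hf.intervalIntegrable _ _)]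
  rw [heq]
  exact ((hF.comp (differentiable_id.add_const ε)).sub hF).const_mul (1 / ε)

/-- If `f` is continuous, `a < b`, and `f` fails to be differentiable at some
point of `(a, b)`, then for every `ε > 0` there is `x ∈ (a, b)` at which the
deviation `Δ_ε f(x) = f(x) - f⁺(x, ε)` is nonzero. -/
theorem exists_deviation_ne_zero_of_not_differentiableAt (f : ℝ → ℝ)
    (hf : Continuous f) (a b : ℝ) (hab : a < b)
    (h : ∃ x ∈ Ioo a b, ¬ DifferentiableAt ℝ f x) :
    ∀ ε > (0 : ℝ), ∃ x ∈ Ioo a b, f x ≠ rightMean f x ε := by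
  intro ε _
  obtain ⟨x, hx, hfx⟩ := h
  by_contra! hmean
  refine hfx ((differentiable_rightMean hf ε x).congr_of_eventuallyEq ?_)
  filter_upwards [isOpen_Ioo.mem_nhds hx] with y hy using hmean y hy
end

section
/- Let f : ℝ → ℝ be continuous and nowhere differentiable on (a,b), where a < b. Then for every ε > 0, the set I_ε = {x ∈ (a,b) : f(x) = f⁺(x,ε)} contains no open neighborhood of any of its points; that is, I_ε has empty interior. -/
open MeasureTheory Set

/-- If `f` is continuous and nowhere differentiable on `(a, b)` with `a < b`,
then for every `ε > 0` the set `I_ε = {x ∈ (a, b) : f(x) = f⁺(x, ε)}` has empty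
interior, i.e. it contains no open neighborhood of any of its points. -/
theorem interior_deviationZeroSet_empty (f : ℝ → ℝ) (hf : Continuous f)
    (a b : ℝ) (hab : a < b)
    (h : ∀ x ∈ Ioo a b, ¬ DifferentiableAt ℝ f x) :
    ∀ ε > (0 : ℝ),
      interior {x : ℝ | x ∈ Ioo a b ∧ f x = rightMean f x ε} = ∅ := by
  intro ε _
  rw [eq_empty_iff_forall_notMem]
  intro x hx
  refine h x (interior_subset hx).1 ?_
  have heq : f =ᶠ[nhds x] fun y => rightMean f y ε :=
    Filter.mem_of_superset (mem_interior_iff_mem_nhds.mp hx) fun y hy => hy.2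
  exact (differentiable_rightMean hf ε x).congr_of_eventuallyEq heq
end

section
/- (Uncertainty Principle) Let f : ℝ → ℝ be continuous and nowhere differentiable on (a,b), where a < b. Then for every ε > 0 and every x ∈ (a,b) with Δ_ε f(x) = f(x) − f⁺(x,ε) ≠ 0, the quantity D_ε − D_x is nonzero and Δ_ε f(x) · Δ_ε P(x) = ε, where D_ε is the derivative at ε of e ↦ f⁺(x,e), D_x is the derivative at x of y ↦ f⁺(y,ε), and Δ_ε P(x) = (D_ε − D_x)⁻¹ is the normal average rate of change. -/
open MeasureTheory Set

/-- The deviation `Δ_ε f(x) = f(x) - f⁺(x, ε)`. -/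
noncomputable def deviation (f : ℝ → ℝ) (x ε : ℝ) : ℝ :=
  f x - rightMean f x ε

/-- The mean function is differentiable in its width, by the fundamental theorem of calculus. -/
theorem hasDerivAt_rightMean_width {f : ℝ → ℝ} (hf : Continuous f) (x : ℝ) {ε : ℝ}
    (hε : ε ≠ 0) :
    HasDerivAt (fun e : ℝ => rightMean f x e) ((f (x + ε) - rightMean f x ε) / ε) ε := by
  have hF : HasDerivAt (fun e : ℝ => ∫ t in x..(x + e), f t) (f (x + ε)) ε :=
    (hf.integral_hasStrictDerivAt x (x + ε)).hasDerivAt.comp_const_add x ε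
  have hinv : HasDerivAt (fun e : ℝ => 1 / e) (-(ε ^ 2)⁻¹) ε := by
    simpa only [one_div] using hasDerivAt_inv hε
  refine (hinv.fun_mul hF).congr_deriv ?_
  unfold rightMean
  field_simp
  ring

/-- The mean function is differentiable in its base point, by the fundamental theorem of
calculus. -/
theorem hasDerivAt_rightMean_point {f : ℝ → ℝ} (hf : Continuous f) (x ε : ℝ) :
    HasDerivAt (fun y : ℝ => rightMean f y ε) ((f (x + ε) - f x) / ε) x := by
  have hright : HasDerivAt (fun y : ℝ => ∫ t in (0 : ℝ)..(y + ε), f t) (f (x + ε)) x :=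
    (hf.integral_hasStrictDerivAt 0 (x + ε)).hasDerivAt.comp_add_const x ε
  have hleft : HasDerivAt (fun y : ℝ => ∫ t in (0 : ℝ)..y, f t) (f x) x :=
    (hf.integral_hasStrictDerivAt 0 x).hasDerivAt
  have hsplit : (fun y : ℝ => rightMean f y ε) = fun y =>
      (1 / ε) * ((∫ t in (0 : ℝ)..(y + ε), f t) - ∫ t in (0 : ℝ)..y, f t) := by
    funext y
    rw [rightMean, intervalIntegral.integral_interval_sub_left
      (hf.intervalIntegrable _ _) (hf.intervalIntegrable _ _)]
  rw [hsplit]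
  exact ((hright.fun_sub hleft).const_mul (1 / ε)).congr_deriv (by ring)

/-- The difference of the partial derivatives of the mean function is the deviation divided by
the width. -/
theorem deriv_rightMean_sub_deriv_rightMean {f : ℝ → ℝ} (hf : Continuous f) (x : ℝ) {ε : ℝ}
    (hε : ε ≠ 0) :
    deriv (fun e : ℝ => rightMean f x e) ε - deriv (fun y : ℝ => rightMean f y ε) x =
      deviation f x ε / ε := by
  rw [(hasDerivAt_rightMean_width hf x hε).deriv, (hasDerivAt_rightMean_point hf x ε).deriv,
    deviation]
  ring

/-- **Uncertainty principle.** If `f` is continuous and nowhere differentiable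
on `(a, b)` with `a < b`, then for every `ε > 0` and every `x ∈ (a, b)` with
`Δ_ε f(x) ≠ 0`, the quantity `D_ε - D_x` is nonzero and
`Δ_ε f(x) · Δ_ε P(x) = ε`, where `D_ε` is the derivative at `ε` of
`e ↦ f⁺(x, e)`, `D_x` is the derivative at `x` of `y ↦ f⁺(y, ε)`, and
`Δ_ε P(x) = (D_ε - D_x)⁻¹`. -/
theorem uncertainty_principle (f : ℝ → ℝ) (hf : Continuous f)
    (a b : ℝ) (hab : a < b)
    (h : ∀ x ∈ Ioo a b, ¬ DifferentiableAt ℝ f x) :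
    ∀ ε > (0 : ℝ), ∀ x ∈ Ioo a b, deviation f x ε ≠ 0 →
      deriv (fun e : ℝ => rightMean f x e) ε -
          deriv (fun y : ℝ => rightMean f y ε) x ≠ 0 ∧
        deviation f x ε *
          (deriv (fun e : ℝ => rightMean f x e) ε -
            deriv (fun y : ℝ => rightMean f y ε) x)⁻¹ = ε := by
  intro ε hε x _ hdev
  rw [deriv_rightMean_sub_deriv_rightMean hf x hε.ne']
  exact ⟨div_ne_zero hdev hε.ne', by field_simp⟩
end

section
/- Let f : ℝ → ℝ be continuous, let a < b, and suppose there exists ε₀ > 0 such that for every x ∈ (a,b) the derivative at ε₀ of the function e ↦ f⁺(x,e) is zero (equivalently, f(x+ε₀) = f⁺(x,ε₀) for all x ∈ (a,b)). Then f is differentiable at every point of (a+ε₀, b+ε₀). In particular, if f is nowhere differentiable on (a,b) and 0 < ε₀ < b − a, then there exists x ∈ (a,b) with f(x+ε₀) ≠ f⁺(x,ε₀). -/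
open MeasureTheory Set

theorem hasDerivAt_rightMean_fst {f : ℝ → ℝ} (hf : Continuous f) (x ε : ℝ) :
    HasDerivAt (fun y => rightMean f y ε) ((1 / ε) * (f (x + ε) - f x)) x := by
  have hF (u : ℝ) : HasDerivAt (fun v => ∫ t in (0 : ℝ)..v, f t) (f u) u :=
    (hf.integral_hasStrictDerivAt _ _).hasDerivAt
  have h := (((hF (x + ε)).comp_add_const x ε).sub (hF x)).const_mul (1 / ε)
  refine h.congr_of_eventuallyEq (.of_forall fun y => ?_)
  simp only [rightMean, Pi.sub_apply]
  rw [intervalIntegral.integral_interval_sub_left (hf.intervalIntegrable _ _)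
    (hf.intervalIntegrable _ _)]

theorem hasDerivAt_rightMean_snd {f : ℝ → ℝ} (hf : Continuous f) (x : ℝ) {ε : ℝ} (hε : ε ≠ 0) :
    HasDerivAt (fun e => rightMean f x e) ((f (x + ε) - rightMean f x ε) / ε) ε := by
  have hF : HasDerivAt (fun v => ∫ t in x..v, f t) (f (x + ε)) (x + ε) :=
    (hf.integral_hasStrictDerivAt _ _).hasDerivAt
  have h := (hasDerivAt_inv hε).mul (hF.comp_const_add x ε)
  refine (h.congr_of_eventuallyEq (.of_forall fun e => ?_)).congr_deriv ?_
  · simp [rightMean]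
  · simp only [rightMean]
    field_simp
    ring

theorem deriv_rightMean_snd_eq_zero_iff {f : ℝ → ℝ} (hf : Continuous f) (x : ℝ) {ε : ℝ}
    (hε : ε ≠ 0) :
    deriv (fun e => rightMean f x e) ε = 0 ↔ f (x + ε) = rightMean f x ε := by
  rw [(hasDerivAt_rightMean_snd hf x hε).deriv, div_eq_zero_iff, or_iff_left hε, sub_eq_zero]

theorem differentiableAt_of_eq_rightMean {f : ℝ → ℝ} (hf : Continuous f) {a b ε : ℝ}
    (h : ∀ x ∈ Ioo a b, f (x + ε) = rightMean f x ε) {x : ℝ}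
    (hx : x ∈ Ioo (a + ε) (b + ε)) : DifferentiableAt ℝ f x := by
  have hd := ((hasDerivAt_rightMean_fst hf (x - ε) ε).comp_sub_const x ε).differentiableAt
  refine hd.congr_of_eventuallyEq ?_
  filter_upwards [isOpen_Ioo.mem_nhds hx] with y hy
  simpa using h (y - ε) ⟨by linarith [hy.1], by linarith [hy.2]⟩

/-- Let `f` be continuous and `a < b`. If there is `ε₀ > 0` such that for every
`x ∈ (a, b)` the derivative at `ε₀` of `e ↦ f⁺(x, e)` is zero (equivalently,
`f(x + ε₀) = f⁺(x, ε₀)` for all `x ∈ (a, b)`), then `f` is differentiable at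
every point of `(a + ε₀, b + ε₀)`.  In particular, if `f` is nowhere
differentiable on `(a, b)` and `0 < ε₀ < b - a`, then there is `x ∈ (a, b)`
with `f(x + ε₀) ≠ f⁺(x, ε₀)`. -/
theorem differentiable_shift_of_deriv_snd_zero (f : ℝ → ℝ) (hf : Continuous f)
    (a b : ℝ) (hab : a < b) (ε₀ : ℝ) (hε₀ : 0 < ε₀) :
    ((∀ x ∈ Ioo a b, deriv (fun e : ℝ => rightMean f x e) ε₀ = 0) →
      ∀ x ∈ Ioo (a + ε₀) (b + ε₀), DifferentiableAt ℝ f x) ∧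
    ((∀ x ∈ Ioo a b, ¬ DifferentiableAt ℝ f x) → ε₀ < b - a →
      ∃ x ∈ Ioo a b, f (x + ε₀) ≠ rightMean f x ε₀) := by
  refine ⟨fun h x hx => differentiableAt_of_eq_rightMean hf
    (fun y hy => (deriv_rightMean_snd_eq_zero_iff hf y hε₀.ne').1 (h y hy)) hx, fun h hlt => ?_⟩
  by_contra! hcon
  obtain ⟨x, hx₁, hx₂⟩ := exists_between (show a + ε₀ < b by linarith)
  exact h x ⟨by linarith, hx₂⟩ (differentiableAt_of_eq_rightMean hf hcon ⟨hx₁, by linarith⟩)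
end

section
/- Let f : ℝ → ℝ be continuous, let x₀ ∈ ℝ and let ε₀ > 0. If the derivative at x₀ of the function y ↦ f⁺(y,ε₀) is zero and the derivative at ε₀ of the function e ↦ f⁺(x₀,e) is zero, then the deviation vanishes: f(x₀) = f⁺(x₀,ε₀). -/
open MeasureTheory

/-- The derivative of the right mean of a continuous function in the base point. -/
theorem hasDerivAt_rightMean_left {f : ℝ → ℝ} (hf : Continuous f) (x ε : ℝ) :
    HasDerivAt (fun y : ℝ => rightMean f y ε) ((1 / ε) * (f (x + ε) - f x)) x := by
  have hF : ∀ u : ℝ, HasDerivAt (fun u => ∫ t in x..u, f t) (f u) u := fun u =>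
    hf.integral_hasStrictDerivAt x u |>.hasDerivAt
  have hsub : (fun y : ℝ => rightMean f y ε) =
      fun y => (1 / ε) * ((∫ t in x..(y + ε), f t) - ∫ t in x..y, f t) := by
    funext y
    rw [rightMean, intervalIntegral.integral_interval_sub_left
      (hf.intervalIntegrable _ _) (hf.intervalIntegrable _ _)]
  rw [hsub]
  exact (((hF (x + ε)).comp_add_const x ε).sub (hF x)).const_mul (1 / ε)

/-- The derivative of the right mean of a continuous function in the length of the interval. -/
theorem hasDerivAt_rightMean_right {f : ℝ → ℝ} (hf : Continuous f) (x : ℝ) {ε : ℝ}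
    (hε : ε ≠ 0) :
    HasDerivAt (fun e : ℝ => rightMean f x e) ((1 / ε) * (f (x + ε) - rightMean f x ε)) ε := by
  have hF : HasDerivAt (fun e => ∫ t in x..(x + e), f t) (f (x + ε)) ε :=
    (hf.integral_hasStrictDerivAt x (x + ε)).hasDerivAt.comp_const_add x ε
  have h := (hasDerivAt_inv hε).mul hF
  simp only [rightMean, one_div]
  refine h.congr_deriv ?_
  field_simp
  ring

/-- If `f` is continuous, `x₀ ∈ ℝ` and `ε₀ > 0`, and both the derivative at
`x₀` of `y ↦ f⁺(y, ε₀)` and the derivative at `ε₀` of `e ↦ f⁺(x₀, e)` vanish,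
then the deviation vanishes: `f(x₀) = f⁺(x₀, ε₀)`. -/
theorem deviation_eq_zero_of_derivs_eq_zero (f : ℝ → ℝ) (hf : Continuous f)
    (x₀ ε₀ : ℝ) (hε₀ : 0 < ε₀)
    (hx : deriv (fun y : ℝ => rightMean f y ε₀) x₀ = 0)
    (he : deriv (fun e : ℝ => rightMean f x₀ e) ε₀ = 0) :
    f x₀ = rightMean f x₀ ε₀ := by
  have hε : 1 / ε₀ ≠ 0 := one_div_ne_zero hε₀.ne'
  rw [(hasDerivAt_rightMean_left hf x₀ ε₀).deriv] at hx
  rw [(hasDerivAt_rightMean_right hf x₀ hε₀.ne').deriv] at he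
  have h₁ := (mul_eq_zero.mp hx).resolve_left hε
  have h₂ := (mul_eq_zero.mp he).resolve_left hε
  linarith
end
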